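/- arXiv:2511.09874 — 7 statements merged into one kernel-verified Lean document; each statement's English description precedes it below -/
import Mathlib

section
/- Let S be a numerical semigroup with gap set G, Frobenius number γ and multiplicity α. If (a₁, a₂, a₃) with a₁ ≤ a₂ ≤ a₃ is an exceptional triple of S and a₂ ≤ α − 1, then a₂ = α − 1 and the integer intervals [α, α + a₁ − 2], [a₃ + 1, a₃ + α − 2] and [a₃ + 1, a₃ + a₁ − 1] are contained in S. -/
/-- A numerical semigroup: a subset of ℕ containing 0, closed under addition,
whose complement (the set of gaps) is finite and nonempty. -/
def IsNumericalSemigroup (S : Set ℕ) : Prop :=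
  0 ∈ S ∧ (∀ a ∈ S, ∀ b ∈ S, a + b ∈ S) ∧ Sᶜ.Finite ∧ Sᶜ.Nonempty

/-- `γ` is the Frobenius number of `S`: the largest gap. -/
def IsFrobenius (S : Set ℕ) (γ : ℕ) : Prop :=
  γ ∉ S ∧ ∀ x, x ∉ S → x ≤ γ

/-- `α` is the multiplicity of `S`: the least nonzero element. -/
def IsMultiplicity (S : Set ℕ) (α : ℕ) : Prop :=
  α ∈ S ∧ 0 < α ∧ ∀ x ∈ S, 0 < x → α ≤ x

/-- A pair of gaps `(b₁, b₂)` with `b₁ ≤ b₂` is minimal if it is lexicographically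
smallest among all pairs of gaps with the same sum. -/
def MinimalPair (S : Set ℕ) (b₁ b₂ : ℕ) : Prop :=
  b₁ ∉ S ∧ b₂ ∉ S ∧ b₁ ≤ b₂ ∧
    ∀ c₁ c₂ : ℕ, c₁ ∉ S → c₂ ∉ S → c₁ ≤ c₂ → c₁ + c₂ = b₁ + b₂ → b₁ ≤ c₁

/-- An exceptional triple of gaps: each of the three pairs is minimal
and no entry equals `1` or `γ`. -/
def ExceptionalTriple (S : Set ℕ) (γ a₁ a₂ a₃ : ℕ) : Prop :=
  a₁ ≤ a₂ ∧ a₂ ≤ a₃ ∧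
    MinimalPair S a₁ a₂ ∧ MinimalPair S a₁ a₃ ∧ MinimalPair S a₂ a₃ ∧
    a₁ ≠ 1 ∧ a₂ ≠ 1 ∧ a₃ ≠ 1 ∧ a₁ ≠ γ ∧ a₂ ≠ γ ∧ a₃ ≠ γ

/-- `S` is symmetric (with Frobenius number `γ`). -/
def SymmetricNS (S : Set ℕ) (γ : ℕ) : Prop :=
  ∀ x ≤ γ, (x ∈ S ↔ γ - x ∉ S)

/-- `S` is pseudo-symmetric (with Frobenius number `γ`). -/
def PseudoSymmetric (S : Set ℕ) (γ : ℕ) : Prop :=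
  2 ∣ γ ∧ ∀ x, x ∉ S → x ≠ γ / 2 → γ - x ∈ S

/-- `τ` is the largest positive integer such that `α, 2α, …, τα` are exactly the
`τ` smallest nonzero elements of `S`. -/
def IsTau (S : Set ℕ) (α τ : ℕ) : Prop :=
  0 < τ ∧ (∀ x ∈ S, 0 < x → x ≤ τ * α → α ∣ x) ∧
    ∀ τ' : ℕ, τ < τ' → ¬ (∀ x ∈ S, 0 < x → x ≤ τ' * α → α ∣ x)

/-- The integer interval `[γ − mα + 1, γ − 1 − (m−1)α]` is contained in `S`. -/
def MIntervalInS (S : Set ℕ) (γ α m : ℕ) : Prop :=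
  ∀ x : ℤ, (γ : ℤ) - m * α + 1 ≤ x → x ≤ (γ : ℤ) - 1 - ((m : ℤ) - 1) * α →
    ∃ n ∈ S, (n : ℤ) = x

/-- `m` is the largest integer such that `[γ − mα + 1, γ − 1 − (m−1)α] ⊆ S`. -/
def IsM (S : Set ℕ) (γ α m : ℕ) : Prop :=
  MIntervalInS S γ α m ∧ ∀ m' : ℕ, m < m' → ¬ MIntervalInS S γ α m'

/-- The set `K = {a ∈ ℕ | γ − a ∉ S}` (where `γ − a` is taken in ℤ). -/
def Kset (S : Set ℕ) (γ : ℕ) : Set ℕ := {a | ¬ ∃ s ∈ S, s + a = γ}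

/-- If `(b₁, b₂)` is a minimal pair with `b₁` below the multiplicity, then every integer strictly
between `b₂` and `b₁ + b₂` lies in `S`. -/
theorem MinimalPair.mem_of_lt_of_lt {S : Set ℕ} {α b₁ b₂ x : ℕ} (h : MinimalPair S b₁ b₂)
    (hα : IsMultiplicity S α) (hb : b₁ < α) (hx : b₂ < x) (hx' : x < b₁ + b₂) : x ∈ S := by
  obtain ⟨-, -, hle, hmin⟩ := h
  by_contra hxS
  have hgap : b₁ + b₂ - x ∉ S := fun hm ↦ by
    have := hα.2.2 _ hm (by omega)
    omega
  have := hmin _ _ hgap hxS (by omega) (by omega)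
  omega

/-- exceptional triples with `a₂ ≤ α − 1`. -/
theorem statement_2 (S : Set ℕ) (hS : IsNumericalSemigroup S)
    (γ α : ℕ) (hγ : IsFrobenius S γ) (hα : IsMultiplicity S α)
    (a₁ a₂ a₃ : ℕ) (h : ExceptionalTriple S γ a₁ a₂ a₃) (ha₂ : a₂ ≤ α - 1) :
    a₂ = α - 1 ∧
    (∀ x : ℕ, α ≤ x → x ≤ α + a₁ - 2 → x ∈ S) ∧
    (∀ x : ℕ, a₃ + 1 ≤ x → x ≤ a₃ + α - 2 → x ∈ S) ∧
    (∀ x : ℕ, a₃ + 1 ≤ x → x ≤ a₃ + a₁ - 1 → x ∈ S) := by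
  obtain ⟨h₁₂, -, hp₁₂, hp₁₃, hp₂₃, h₁, -⟩ := h
  have h₀ : a₁ ≠ 0 := fun h₀ ↦ hp₁₂.1 (h₀ ▸ hS.1)
  have hα₀ := hα.2.1
  have ha : a₂ = α - 1 := by
    have := hα.2.2 _ (hp₁₂.mem_of_lt_of_lt (x := a₂ + 1) hα (by omega) (by omega) (by omega))
      (by omega)
    omega
  exact ⟨ha,
    fun x _ _ ↦ hp₁₂.mem_of_lt_of_lt hα (by omega) (by omega) (by omega),
    fun x _ _ ↦ hp₂₃.mem_of_lt_of_lt hα (by omega) (by omega) (by omega),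
    fun x _ _ ↦ hp₁₃.mem_of_lt_of_lt hα (by omega) (by omega) (by omega)⟩
end

section
/- Let S be a numerical semigroup with gap set G and Frobenius number γ. If S is not symmetric, then every integer n with 2 ≤ n ≤ γ can be written as a sum of two gaps of S; equivalently, every integer in the interval [γ, 2(γ−1)] lies in (γ − G) + (γ − G). -/
/-- Multiples of an element of a numerical semigroup belong to the semigroup. -/
theorem IsNumericalSemigroup.mul_mem {S : Set ℕ} (hS : IsNumericalSemigroup S) {a : ℕ}
    (ha : a ∈ S) (k : ℕ) : k * a ∈ S := by
  induction k with
  | zero => simpa using hS.1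
  | succ k ih => rw [Nat.succ_mul]; exact hS.2.1 _ ih _ ha

/-- To prove symmetry it suffices to reflect gaps into the semigroup. -/
theorem IsNumericalSemigroup.symmetricNS_of_gaps {S : Set ℕ} (hS : IsNumericalSemigroup S)
    {γ : ℕ} (hγ : IsFrobenius S γ) (h : ∀ x, x ∉ S → γ - x ∈ S) : SymmetricNS S γ := by
  intro x hx
  refine ⟨fun hxS hyS => hγ.1 ?_, fun hyS => by_contra fun hxS => hyS (h x hxS)⟩
  simpa [Nat.add_sub_cancel' hx] using hS.2.1 _ hxS _ hyS

/-- If some `n` with `2 ≤ n ≤ γ` is not a sum of two gaps, then all gaps that are at least `n`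
are congruent to `n` modulo the multiplicity, which forces symmetry. -/
theorem IsNumericalSemigroup.symmetricNS_of_not_sum_gaps {S : Set ℕ}
    (hS : IsNumericalSemigroup S) {γ : ℕ} (hγ : IsFrobenius S γ) {n : ℕ} (hn : 2 ≤ n)
    (hnγ : n ≤ γ) (h : ∀ x ≤ n, x ∉ S → n - x ∈ S) : SymmetricNS S γ := by
  classical
  have one_notMem : 1 ∉ S := fun h1 => hγ.1 (by simpa using hS.mul_mem h1 γ)
  have hpos : ∃ a, a ∈ S ∧ 0 < a := ⟨n - 1, h 1 (by omega) one_notMem, by omega⟩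
  obtain ⟨α, ⟨hαS, hα⟩, hmin⟩ : ∃ α, (α ∈ S ∧ 0 < α) ∧ ∀ a ∈ S, 0 < a → α ≤ a :=
    ⟨Nat.find hpos, Nat.find_spec hpos, fun a ha ha' => Nat.find_min' hpos ⟨ha, ha'⟩⟩
  have hαn : α ≤ n - 1 := hmin _ (h 1 (by omega) one_notMem) (by omega)
  have gap_eq : ∀ x, x ∉ S → n ≤ x → ∃ j, x = n + j * α := by
    intro x hx hnx
    refine ⟨(x - n) / α, by_contra fun hne => hx ?_⟩
    have hdiv := Nat.mod_add_div' (x - n) α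
    have hlt := Nat.mod_lt (x - n) hα
    set q := (x - n) / α
    set r := (x - n) % α
    have hr : 0 < r := by by_contra hr; exact hne (by omega)
    have hgap : α - r ∉ S := fun hm => by
      have := hmin _ hm (by omega)
      omega
    have hx_eq : x = (n - (α - r)) + (q + 1) * α := by
      rw [Nat.succ_mul]
      omega
    rw [hx_eq]
    exact hS.2.1 _ (h _ (by omega) hgap) _ (hS.mul_mem hαS _)
  obtain ⟨k, hk⟩ := gap_eq γ hγ.1 hnγ
  refine hS.symmetricNS_of_gaps hγ fun x hx => ?_
  rcases le_total x n with hxn | hnx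
  · have : γ - x = (n - x) + k * α := by omega
    rw [this]
    exact hS.2.1 _ (h x hxn hx) _ (hS.mul_mem hαS k)
  · obtain ⟨j, hj⟩ := gap_eq x hx hnx
    have : γ - x = (k - j) * α := by
      rw [Nat.sub_mul]
      omega
    rw [this]
    exact hS.mul_mem hαS _

/-- if `S` is not symmetric, every `2 ≤ n ≤ γ` is a sum of two gaps;
equivalently every integer in `[γ, 2(γ−1)]` lies in `(γ − G) + (γ − G)`. -/
theorem statement_7 (S : Set ℕ) (hS : IsNumericalSemigroup S)
    (γ : ℕ) (hγ : IsFrobenius S γ) (hns : ¬ SymmetricNS S γ) :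
    (∀ n : ℕ, 2 ≤ n → n ≤ γ → ∃ a b : ℕ, a ∉ S ∧ b ∉ S ∧ a + b = n) ∧
    (∀ n : ℕ, γ ≤ n → n ≤ 2 * (γ - 1) →
      ∃ a b : ℕ, a ∉ S ∧ b ∉ S ∧ (γ - a) + (γ - b) = n) := by
  have key : ∀ n : ℕ, 2 ≤ n → n ≤ γ → ∃ a b : ℕ, a ∉ S ∧ b ∉ S ∧ a + b = n := by
    intro n hn hnγ
    by_contra! hsum
    refine hns (hS.symmetricNS_of_not_sum_gaps hγ hn hnγ fun x hxn hx => ?_)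
    by_contra hy
    exact hsum x (n - x) hx hy (by omega)
  refine ⟨key, fun n hγn hn => ?_⟩
  have hγ0 : γ ≠ 0 := fun h0 => hγ.1 (h0 ▸ hS.1)
  obtain ⟨a, b, ha, hb, hab⟩ := key (2 * γ - n) (by omega) (by omega)
  have := hγ.2 a ha
  have := hγ.2 b hb
  exact ⟨a, b, ha, hb, by omega⟩
end

section
/- Let α ≥ 3 and k ≥ 1 be integers and suppose that S := {0, α} ∪ {α + 2j : 1 ≤ j ≤ k} ∪ {n ∈ ℕ : n ≥ α + 2k} is closed under addition (so S is a numerical semigroup with Frobenius number γ = α + 2k − 1). Then K = {0, 2, 4, …, γ − α − 1} ∪ [γ − α + 1, γ − 1] ∪ {n ∈ ℕ : n ≥ γ + 1}, and ⟨K⟩ = K ∪ {γ}. -/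
/-- the second family of trigonal semigroups is nearly Gorenstein. -/
theorem statement_12 (α k : ℕ) (hα : 3 ≤ α) (hk : 1 ≤ k)
    (S : Set ℕ)
    (hSdef : S = {0, α} ∪ {x : ℕ | ∃ j : ℕ, 1 ≤ j ∧ j ≤ k ∧ x = α + 2 * j} ∪
      {n : ℕ | α + 2 * k ≤ n})
    (hadd : ∀ a ∈ S, ∀ b ∈ S, a + b ∈ S)
    (γ : ℕ) (hγdef : γ = α + 2 * k - 1) :
    IsNumericalSemigroup S ∧ IsFrobenius S γ ∧
    Kset S γ = {x : ℕ | 2 ∣ x ∧ x ≤ γ - α - 1} ∪ Set.Icc (γ - α + 1) (γ - 1) ∪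
      {n : ℕ | γ + 1 ≤ n} ∧
    (AddSubmonoid.closure (Kset S γ) : Set ℕ) = Kset S γ ∪ {γ} := by
  have hmem : ∀ x, x ∈ S ↔ x = 0 ∨ (α ≤ x ∧ 2 ∣ x - α) ∨ α + 2 * k ≤ x := by
    intro x
    simp only [hSdef, Set.mem_union, Set.mem_insert_iff, Set.mem_singleton_iff, Set.mem_ofPred_eq]
    constructor
    · rintro (((h | h) | ⟨j, _, _, h⟩) | h) <;> omega
    · rintro (h | ⟨h, j, hj⟩ | h)
      · exact Or.inl (Or.inl (Or.inl h))
      · by_cases hx : α + 2 * k ≤ x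
        · exact Or.inr hx
        · by_cases hj0 : j = 0
          · exact Or.inl (Or.inl (Or.inr (by omega)))
          · exact Or.inl (Or.inr ⟨j, by omega, by omega, by omega⟩)
      · exact Or.inr h
  have hγS : γ ∉ S := by rw [hmem]; omega
  have hfrob : ∀ x, x ∉ S → x ≤ γ := by
    intro x hx
    rw [hmem] at hx
    omega
  have hK : ∀ a, a ∈ Kset S γ ↔
      (2 ∣ a ∧ a ≤ γ - α - 1) ∨ (γ - α + 1 ≤ a ∧ a ≤ γ - 1) ∨ γ + 1 ≤ a := by
    intro a
    have h : a ∈ Kset S γ ↔ γ < a ∨ γ - a ∉ S := by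
      constructor
      · intro h
        by_contra! hc
        exact h ⟨γ - a, hc.2, by omega⟩
      · rintro h ⟨s, hs, hsa⟩
        rcases h with h | h
        · omega
        · exact h (by rwa [show γ - a = s by omega])
    rw [h, hmem]
    omega
  refine ⟨⟨(hmem 0).2 (Or.inl rfl), hadd, (Set.finite_Iic γ).subset hfrob, γ, hγS⟩,
    ⟨hγS, hfrob⟩, ?_, ?_⟩
  · ext a
    simp only [hK, Set.mem_union, Set.mem_ofPred_eq, Set.mem_Icc, or_assoc]
  · apply Set.Subset.antisymm
    · intro x hx
      induction hx using AddSubmonoid.closure_induction with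
      | mem x hx => exact Or.inl hx
      | zero => exact Or.inl ((hK 0).2 (by omega))
      | add x y _ _ hx hy =>
        simp only [Set.mem_union, hK, Set.mem_singleton_iff] at hx hy ⊢
        omega
    · rintro x (hx | rfl)
      · exact AddSubmonoid.subset_closure hx
      · have h := add_mem (AddSubmonoid.subset_closure ((hK 2).2 (by omega)))
          (AddSubmonoid.subset_closure ((hK (x - 2)).2 (by omega)))
        rwa [show 2 + (x - 2) = x by omega] at h
end

section
/- Let S be a non-symmetric numerical semigroup with multiplicity α = 3 and Frobenius number γ. Then ⟨K⟩ = K ∪ {γ} if and only if S is pseudo-symmetric. In particular, if ⟨K⟩ = K ∪ {γ}, then any gaps a ≤ b of S with a + b = γ satisfy a = b = γ/2. -/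
theorem mul_mem_of_add_closed {S : Set ℕ} (h0 : 0 ∈ S)
    (hadd : ∀ a ∈ S, ∀ b ∈ S, a + b ∈ S) {m : ℕ} (hm : m ∈ S) (n : ℕ) : n * m ∈ S := by
  induction n with
  | zero => simpa using h0
  | succ n ih => simpa [Nat.succ_mul] using hadd _ ih _ hm

theorem mem_Kset_of_add_eq {S : Set ℕ} {γ x y : ℕ} (hy : y ∉ S) (h : x + y = γ) :
    x ∈ Kset S γ := by
  rintro ⟨s, hs, hsx⟩
  obtain rfl : s = y := by omega
  exact hy hs

/-- If `⟨K⟩ = K ∪ {γ}` and `3 ∈ S`, two gaps with sum `γ` coincide. -/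
theorem gap_le_of_closure_Kset {S : Set ℕ} {γ : ℕ} (h0 : 0 ∈ S)
    (hadd : ∀ a ∈ S, ∀ b ∈ S, a + b ∈ S) (h3 : 3 ∈ S) (hγ : γ ∉ S)
    (hK : (AddSubmonoid.closure (Kset S γ) : Set ℕ) = Kset S γ ∪ {γ})
    {x y : ℕ} (hx : x ∉ S) (hy : y ∉ S) (hxy : x + y = γ) : y ≤ x := by
  have mod_ne : ∀ z, z ∉ S → z % 3 ≠ 0 := fun z hz h => hz <| by
    simpa [Nat.div_mul_cancel (Nat.dvd_of_mod_eq_zero h)] using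
      mul_mem_of_add_closed h0 hadd h3 (z / 3)
  have hx3 := mod_ne x hx
  have hy3 := mod_ne y hy
  have hγ3 := mod_ne γ hγ
  by_contra! hlt
  have hxK : x ∈ AddSubmonoid.closure (Kset S γ) :=
    AddSubmonoid.subset_closure (mem_Kset_of_add_eq hy hxy)
  have h2x : x + x ∈ Kset S γ ∪ {γ} := hK ▸ add_mem hxK hxK
  rcases h2x with h | h
  · refine h ⟨y - x, ?_, by omega⟩
    by_contra hd
    have hd3 := mod_ne _ hd
    have hx12 : x % 3 = 1 ∨ x % 3 = 2 := by omega
    have hy12 : y % 3 = 1 ∨ y % 3 = 2 := by omega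
    omega
  · have : x + x = γ := h
    omega

theorem closure_Kset_of_pseudoSymmetric {S : Set ℕ} {γ : ℕ}
    (hadd : ∀ a ∈ S, ∀ b ∈ S, a + b ∈ S) (hγ : γ ∉ S) (hps : PseudoSymmetric S γ) :
    (AddSubmonoid.closure (Kset S γ) : Set ℕ) = Kset S γ ∪ {γ} := by
  obtain ⟨heven, hps⟩ := hps
  have of_gap : ∀ x y, x ∉ S → x + y = γ → x ≠ γ / 2 → y ∈ S := fun x y hx hxy hne => by
    obtain rfl : y = γ - x := by omega
    exact hps x hx hne
  apply Set.Subset.antisymm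
  · intro x hx
    induction hx using AddSubmonoid.closure_induction with
    | mem x hx => exact Or.inl hx
    | zero => exact Or.inl (mem_Kset_of_add_eq hγ (zero_add γ))
    | add a b _ _ ha hb =>
      by_contra hab
      simp only [Set.mem_union, Set.mem_singleton_iff, not_or] at hab
      obtain ⟨habK, hne⟩ := hab
      obtain ⟨s, hs, hsab⟩ := not_not.mp habK
      rcases ha with ha | ha
      · rcases hb with hb | hb
        · have hbs : b + s ∉ S := fun h => ha ⟨_, h, by omega⟩
          have has : a + s ∉ S := fun h => hb ⟨_, h, by omega⟩
          have h1 : b + s = γ / 2 := by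
            by_contra h
            exact has (hadd _ (of_gap _ a hbs (by omega) h) _ hs)
          have h2 : a + s = γ / 2 := by
            by_contra h
            exact hbs (hadd _ (of_gap _ b has (by omega) h) _ hs)
          omega
        · have : b = γ := hb
          omega
      · have : a = γ := ha
        omega
  · rintro x (hx | rfl)
    · exact AddSubmonoid.subset_closure hx
    · have hsum : x / 2 + x / 2 = x := by omega
      have hgap : x / 2 ∉ S := fun h => hγ (hsum ▸ hadd _ h _ h)
      have hK : x / 2 ∈ AddSubmonoid.closure (Kset S x) :=
        AddSubmonoid.subset_closure (mem_Kset_of_add_eq hgap hsum)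
      have := add_mem hK hK
      rwa [hsum] at this

/-- non-symmetric semigroups of multiplicity 3. -/
theorem statement_13 (S : Set ℕ) (hS : IsNumericalSemigroup S)
    (γ : ℕ) (hγ : IsFrobenius S γ)
    (hα : IsMultiplicity S 3) (hns : ¬ SymmetricNS S γ) :
    (((AddSubmonoid.closure (Kset S γ) : Set ℕ) = Kset S γ ∪ {γ}) ↔
      PseudoSymmetric S γ) ∧
    (((AddSubmonoid.closure (Kset S γ) : Set ℕ) = Kset S γ ∪ {γ}) →
      ∀ a b : ℕ, a ∉ S → b ∉ S → a ≤ b → a + b = γ → a = γ / 2 ∧ b = γ / 2) := by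
 
  obtain ⟨h0, hadd, -, -⟩ := hS
  have gaps_eq : (AddSubmonoid.closure (Kset S γ) : Set ℕ) = Kset S γ ∪ {γ} →
      ∀ a b : ℕ, a ∉ S → b ∉ S → a + b = γ → a = b := fun hK a b ha hb hab =>
    le_antisymm
      (gap_le_of_closure_Kset h0 hadd hα.1 hγ.1 hK hb ha (by omega))
      (gap_le_of_closure_Kset h0 hadd hα.1 hγ.1 hK ha hb hab)
  refine ⟨⟨fun hK => ?_, closure_Kset_of_pseudoSymmetric hadd hγ.1⟩, fun hK a b ha hb _ hab => ?_⟩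
  · refine ⟨?_, fun x hx hne => ?_⟩
    · by_contra hodd
      refine hns fun x hxγ => ⟨fun hx hx' => hγ.1 ?_, fun hx' => ?_⟩
      · simpa [Nat.add_sub_cancel' hxγ] using hadd _ hx _ hx'
      · by_contra hx
        have := gaps_eq hK x (γ - x) hx hx' (by omega)
        omega
    · by_contra hx'
      have hxγ := hγ.2 x hx
      have := gaps_eq hK x (γ - x) hx hx' (by omega)
      omega
  · have := gaps_eq hK a b ha hb hab
    omega
end

section
/- Let α ≥ 4 be an integer and let S be the additive submonoid of ℕ generated by {α} ∪ {j ∈ ℕ : α(α−2) + 3 ≤ j ≤ α(α−1) − 1} ∪ {α(α−1) + 1}. Then the complement ℕ \ S equals (⋃_{i=1}^{α−2} [(i−1)α + 1, iα − 1]) ∪ {(α−2)α + 1, (α−2)α + 2} ∪ {(α−2)α + 2 + jα : 1 ≤ j ≤ α − 2}. In particular S is a numerical semigroup whose Frobenius number is (2α − 4)α + 2. -/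
/-- The condition on quotient `q` and remainder `r` for `α * q + r` to lie in the semigroup
generated by `α`, the interval `[α(α-2)+3, α(α-1)-1]` and `α(α-1)+1`: the quotient is at least
that of the Apéry element in the residue class of `r`. -/
def AperyBound (α q r : ℕ) : Prop :=
  r = 0 ∨ (r = 1 ∧ α ≤ q + 1) ∨ (r = 2 ∧ 2 * α ≤ q + 3) ∨ (3 ≤ r ∧ α ≤ q + 2)

theorem exists_aperyBound_of_mem_closure {α : ℕ} (hα : 4 ≤ α) {x : ℕ}
    (hx : x ∈ AddSubmonoid.closure
      ({α} ∪ Set.Icc (α * (α - 2) + 3) (α * (α - 1) - 1) ∪ {α * (α - 1) + 1})) :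
    ∃ q r, r < α ∧ x = α * q + r ∧ AperyBound α q r := by
  induction hx using AddSubmonoid.closure_induction with
  | mem x hx =>
    rcases hx with (rfl | ⟨h₁, h₂⟩) | rfl
    · exact ⟨1, 0, by omega, by ring, .inl rfl⟩
    · have h : α * (α - 1) = α * (α - 2) + α := by
        rw [← Nat.mul_succ]; congr 1; omega
      refine ⟨α - 2, x - α * (α - 2), by omega, by omega, ?_⟩
      unfold AperyBound
      omega
    · refine ⟨α - 1, 1, by omega, rfl, ?_⟩
      unfold AperyBound
      omega
  | zero => exact ⟨0, 0, by omega, rfl, .inl rfl⟩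
  | add x y _ _ ihx ihy =>
    obtain ⟨q, r, hr, rfl, h⟩ := ihx
    obtain ⟨q', r', hr', rfl, h'⟩ := ihy
    unfold AperyBound at h h' ⊢
    by_cases hrr : r + r' < α
    · exact ⟨q + q', r + r', hrr, by ring, by omega⟩
    · refine ⟨q + q' + 1, r + r' - α, by omega, ?_, by omega⟩
      have : α * (q + q' + 1) = α * q + α * q' + α := by ring
      omega

theorem mem_closure_of_aperyBound {α q r : ℕ} (hα : 4 ≤ α) (hr : r < α) (h : AperyBound α q r) :
    α * q + r ∈ AddSubmonoid.closure
      ({α} ∪ Set.Icc (α * (α - 2) + 3) (α * (α - 1) - 1) ∪ {α * (α - 1) + 1}) := by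
  set S := AddSubmonoid.closure
    ({α} ∪ Set.Icc (α * (α - 2) + 3) (α * (α - 1) - 1) ∪ {α * (α - 1) + 1}) with hS
  have shift {q₀ q r : ℕ} (hq : q₀ ≤ q) (h₀ : α * q₀ + r ∈ S) : α * q + r ∈ S := by
    have hmul : (q - q₀) • α ∈ S :=
      S.nsmul_mem (AddSubmonoid.subset_closure (.inl (.inl rfl))) _
    have key := S.add_mem hmul h₀
    obtain ⟨d, rfl⟩ := Nat.exists_eq_add_of_le hq
    convert key using 1
    simp only [Nat.add_sub_cancel_left, smul_eq_mul]
    ring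
  have interval {r : ℕ} (h3 : 3 ≤ r) (hr : r < α) : α * (α - 2) + r ∈ S := by
    have h : α * (α - 1) = α * (α - 2) + α := by
      rw [← Nat.mul_succ]; congr 1; omega
    exact AddSubmonoid.subset_closure (.inl (.inr ⟨by omega, by omega⟩))
  rcases h with rfl | ⟨rfl, hq⟩ | ⟨rfl, hq⟩ | ⟨h3, hq⟩
  · exact shift (Nat.zero_le q) S.zero_mem
  · exact shift (q₀ := α - 1) (by omega) (AddSubmonoid.subset_closure (.inr rfl))
  · refine shift (q₀ := 2 * α - 3) (by omega) ?_
    have key := S.add_mem (interval le_rfl (by omega)) (interval (r := α - 1) (by omega) (by omega))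
    convert key using 1
    obtain ⟨k, rfl⟩ := Nat.exists_eq_add_of_le' hα
    rw [show 2 * (k + 4) - 3 = 2 * k + 5 by omega, show k + 4 - 2 = k + 2 by omega,
      show k + 4 - 1 = k + 3 by omega]
    ring
  · exact shift (q₀ := α - 2) (by omega) (interval h3 hr)

theorem mem_closure_iff_aperyBound {α q r : ℕ} (hα : 4 ≤ α) (hr : r < α) :
    α * q + r ∈ AddSubmonoid.closure
      ({α} ∪ Set.Icc (α * (α - 2) + 3) (α * (α - 1) - 1) ∪ {α * (α - 1) + 1}) ↔
    AperyBound α q r := by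
  refine ⟨fun h => ?_, mem_closure_of_aperyBound hα hr⟩
  obtain ⟨q', r', hr', heq, h'⟩ := exists_aperyBound_of_mem_closure hα h
  have hmod := congrArg (· % α) heq
  simp only [Nat.mul_add_mod, Nat.mod_eq_of_lt hr, Nat.mod_eq_of_lt hr'] at hmod
  subst hmod
  obtain rfl := Nat.eq_of_mul_eq_mul_left (by omega) (Nat.add_right_cancel heq)
  exact h'

/-- the gap set of the semigroups of Theorem 4.10. -/
theorem statement_14 (α : ℕ) (hα : 4 ≤ α)
    (S : AddSubmonoid ℕ)
    (hSdef : S = AddSubmonoid.closure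
      ({α} ∪ Set.Icc (α * (α - 2) + 3) (α * (α - 1) - 1) ∪ {α * (α - 1) + 1})) :
    ((S : Set ℕ)ᶜ =
      (⋃ i ∈ Set.Icc 1 (α - 2), Set.Icc ((i - 1) * α + 1) (i * α - 1)) ∪
      ({(α - 2) * α + 1, (α - 2) * α + 2} : Set ℕ) ∪
      {x : ℕ | ∃ j : ℕ, 1 ≤ j ∧ j ≤ α - 2 ∧ x = (α - 2) * α + 2 + j * α}) ∧
    IsNumericalSemigroup (S : Set ℕ) ∧
    IsFrobenius (S : Set ℕ) ((2 * α - 4) * α + 2) := by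
  have mem_iff {q r : ℕ} (hr : r < α) : α * q + r ∈ S ↔ AperyBound α q r := by
    rw [hSdef]
    exact mem_closure_iff_aperyBound hα hr
  have le_of_notMem {x : ℕ} (hx : x ∉ S) : x ≤ (2 * α - 4) * α + 2 := by
    have hr : x % α < α := Nat.mod_lt _ (by omega)
    rw [← Nat.div_add_mod x α, mem_iff hr, AperyBound] at hx
    rw [← Nat.div_add_mod x α, mul_comm (2 * α - 4)]
    by_cases hr2 : x % α ≤ 2
    · have := Nat.mul_le_mul_left α (show x / α ≤ 2 * α - 4 by omega)
      omega
    · have := Nat.mul_le_mul_left α (show x / α + 1 ≤ 2 * α - 4 by omega)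
      rw [Nat.mul_succ] at this
      omega
  have frobenius_notMem : (2 * α - 4) * α + 2 ∉ S := by
    rw [mul_comm, mem_iff (by omega), AperyBound]
    omega
  refine ⟨?_, ⟨S.zero_mem, fun a ha b hb => S.add_mem ha hb,
    (Set.finite_Iic _).subset fun x hx => le_of_notMem hx, _, frobenius_notMem⟩,
    frobenius_notMem, fun x hx => le_of_notMem hx⟩
  ext x
  simp only [Set.mem_compl_iff, SetLike.mem_coe, Set.mem_union, Set.mem_iUnion, Set.mem_Icc,
    Set.mem_insert_iff, Set.mem_singleton_iff, Set.mem_ofPred_eq, exists_prop]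
  constructor
  · intro hx
    have hr : x % α < α := Nat.mod_lt _ (by omega)
    have hdiv := Nat.div_add_mod x α
    rw [← hdiv, mem_iff hr, AperyBound] at hx
    generalize x / α = q at hdiv hx
    generalize x % α = r at hdiv hx hr
    subst hdiv
    rcases lt_trichotomy q (α - 2) with hq | rfl | hq
    · refine .inl (.inl ⟨q + 1, by omega, ?_⟩)
      rw [Nat.add_sub_cancel, Nat.succ_mul, mul_comm q]
      omega
    · rw [mul_comm (α - 2)]
      omega
    · obtain ⟨j, rfl⟩ := Nat.exists_eq_add_of_lt hq
      obtain rfl : r = 2 := by omega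
      exact .inr ⟨j + 1, by omega, by omega, by ring⟩
  · rintro ((⟨i, ⟨hi, hi'⟩, h₁, h₂⟩ | rfl | rfl) | ⟨j, hj, hj', rfl⟩)
    · obtain ⟨q, rfl⟩ := Nat.exists_eq_add_of_le' hi
      rw [Nat.add_sub_cancel, mul_comm] at h₁
      rw [Nat.succ_mul, mul_comm] at h₂
      rw [← Nat.add_sub_cancel' (show α * q ≤ x by omega), mem_iff (by omega), AperyBound]
      omega
    · rw [mul_comm, mem_iff (by omega), AperyBound]
      omega
    · rw [mul_comm, mem_iff (by omega), AperyBound]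
      omega
    · rw [show (α - 2) * α + 2 + j * α = α * (α - 2 + j) + 2 by ring, mem_iff (by omega),
        AperyBound]
      omega
end

section
/- Let α ≥ 4 be an integer and let S be the additive submonoid of ℕ generated by {α} ∪ {j ∈ ℕ : α(α−2) + 3 ≤ j ≤ α(α−1) − 1} ∪ {α(α−1) + 1}. Then S is a pseudo-symmetric numerical semigroup: its Frobenius number γ = (2α − 4)α + 2 is even, γ/2 = (α−2)α + 1 ∉ S, and for every x ∈ ℕ \ S with x ≠ γ/2 one has γ − x ∈ S. -/
/-- Membership of `k * a + r`, `r < a`, in the semigroup whose Apéry set with respect to `a` is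
`0`, `(a - 1) * a + 1`, `(2 * a - 3) * a + 2` and `(a - 2) * a + r` for `3 ≤ r < a`. -/
def AperyCondition (a k r : ℕ) : Prop :=
  r = 0 ∨ (r = 1 ∧ a ≤ k + 1) ∨ (r = 2 ∧ 2 * a ≤ k + 3) ∨ (3 ≤ r ∧ a ≤ k + 2)

theorem aperyCondition_div_mod_iff {a k r : ℕ} (hr : r < a) :
    AperyCondition a ((k * a + r) / a) ((k * a + r) % a) ↔ AperyCondition a k r := by
  rw [mul_comm, Nat.mul_add_div (by omega), Nat.mul_add_mod, Nat.div_eq_of_lt hr,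
    Nat.mod_eq_of_lt hr, add_zero]

/-- The semigroup with the Apéry set described by `AperyCondition`. -/
def aperySubmonoid (a : ℕ) (ha : 4 ≤ a) : AddSubmonoid ℕ where
  carrier := {n | AperyCondition a (n / a) (n % a)}
  zero_mem' := by simp [AperyCondition]
  add_mem' := by
    intro x y hx hy
    have hxr := Nat.mod_lt x (show a > 0 by omega)
    have hyr := Nat.mod_lt y (show a > 0 by omega)
    have hxe := Nat.div_add_mod' x a
    have hye := Nat.div_add_mod' y a
    simp only [Set.mem_ofPred_eq] at hx hy ⊢
    generalize x / a = k at *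
    generalize x % a = r at *
    generalize y / a = l at *
    generalize y % a = s at *
    subst hxe hye
    by_cases h : r + s < a
    · rw [show k * a + r + (l * a + s) = (k + l) * a + (r + s) by ring,
        aperyCondition_div_mod_iff h]
      unfold AperyCondition at *
      omega
    · obtain ⟨t, ht⟩ := Nat.exists_eq_add_of_le (not_lt.mp h)
      rw [show k * a + r + (l * a + s) = (k + l) * a + (r + s) by ring, ht,
        show (k + l) * a + (a + t) = (k + l + 1) * a + t by ring,
        aperyCondition_div_mod_iff (by omega)]
      unfold AperyCondition at *
      omega

theorem mul_add_mem_aperySubmonoid_iff {a k r : ℕ} (ha : 4 ≤ a) (hr : r < a) :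
    k * a + r ∈ aperySubmonoid a ha ↔ AperyCondition a k r :=
  aperyCondition_div_mod_iff hr

theorem closure_eq_aperySubmonoid {a : ℕ} (ha : 4 ≤ a) :
    AddSubmonoid.closure
      ({a} ∪ Set.Icc (a * (a - 2) + 3) (a * (a - 1) - 1) ∪ {a * (a - 1) + 1}) =
      aperySubmonoid a ha := by
  obtain ⟨b, rfl⟩ := Nat.exists_eq_add_of_le' ha
  rw [show b + 4 - 2 = b + 2 by omega, show b + 4 - 1 = b + 3 by omega]
  have hmul : (b + 4) * (b + 3) = (b + 2) * (b + 4) + (b + 4) := by ring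
  apply le_antisymm
  · rw [AddSubmonoid.closure_le]
    rintro x ((rfl | ⟨h₁, h₂⟩) | rfl)
    · have := mul_add_mem_aperySubmonoid_iff (k := 1) (r := 0) ha (by omega)
      simpa [AperyCondition] using this
    · obtain ⟨r, rfl⟩ := Nat.exists_eq_add_of_le (show (b + 2) * (b + 4) ≤ x by
        rw [mul_comm]; omega)
      rw [mul_comm] at h₁
      rw [SetLike.mem_coe, mul_add_mem_aperySubmonoid_iff ha (by omega)]
      unfold AperyCondition
      omega
    · rw [mul_comm, SetLike.mem_coe, mul_add_mem_aperySubmonoid_iff ha (by omega)]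
      unfold AperyCondition
      omega
  · intro x hx
    set C := AddSubmonoid.closure ({b + 4} ∪ Set.Icc ((b + 4) * (b + 2) + 3)
      ((b + 4) * (b + 3) - 1) ∪ {(b + 4) * (b + 3) + 1})
    have hmultiple (k : ℕ) : k * (b + 4) ∈ C := by
      rw [← smul_eq_mul]
      exact AddSubmonoid.nsmul_mem _ (AddSubmonoid.subset_closure (by simp)) k
    have hmid {r : ℕ} (h₁ : 3 ≤ r) (h₂ : r < b + 4) : (b + 2) * (b + 4) + r ∈ C := by
      refine AddSubmonoid.subset_closure (Or.inl (Or.inr ⟨?_, ?_⟩))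
      · rw [mul_comm]; omega
      · omega
    have hone : (b + 3) * (b + 4) + 1 ∈ C := by
      rw [mul_comm]
      exact AddSubmonoid.subset_closure (by simp)
    have hr := Nat.mod_lt x (show b + 4 > 0 by omega)
    rw [← Nat.div_add_mod' x (b + 4)] at hx ⊢
    rw [mul_add_mem_aperySubmonoid_iff ha hr] at hx
    generalize x / (b + 4) = k at *
    generalize x % (b + 4) = r at *
    rcases hx with rfl | ⟨rfl, h⟩ | ⟨rfl, h⟩ | ⟨h₁, h⟩
    · exact hmultiple k
    · obtain ⟨l, rfl⟩ := Nat.exists_eq_add_of_le (show b + 3 ≤ k by omega)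
      convert C.add_mem hone (hmultiple l) using 1
      ring
    · obtain ⟨l, rfl⟩ := Nat.exists_eq_add_of_le (show 2 * b + 5 ≤ k by omega)
      convert C.add_mem (C.add_mem (hmid le_rfl (by omega))
        (hmid (show 3 ≤ b + 3 by omega) (by omega))) (hmultiple l) using 1
      ring
    · obtain ⟨l, rfl⟩ := Nat.exists_eq_add_of_le (show b + 2 ≤ k by omega)
      convert C.add_mem (hmid h₁ hr) (hmultiple l) using 1
      ring

theorem frobenius_sub_mem_aperySubmonoid {a x : ℕ} (ha : 4 ≤ a)
    (hx : x ∉ aperySubmonoid a ha) (hx' : x ≠ (a - 2) * a + 1) :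
    x ≤ (2 * a - 4) * a + 2 ∧ (2 * a - 4) * a + 2 - x ∈ aperySubmonoid a ha := by
  have hr := Nat.mod_lt x (show a > 0 by omega)
  rw [← Nat.div_add_mod' x a] at hx hx' ⊢
  rw [mul_add_mem_aperySubmonoid_iff ha hr] at hx
  generalize x / a = k at *
  generalize x % a = r at *
  suffices ∃ l s, s < a ∧ AperyCondition a l s ∧
      (2 * a - 4) * a + 2 = k * a + r + (l * a + s) by
    obtain ⟨l, s, hs, hA, he⟩ := this
    refine ⟨by omega, ?_⟩
    rw [he, Nat.add_sub_cancel_left]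
    exact (mul_add_mem_aperySubmonoid_iff ha hs).mpr hA
  have hk : r = 1 → k ≠ a - 2 := by
    rintro rfl rfl
    exact hx' rfl
  unfold AperyCondition at hx ⊢
  by_cases h : r ≤ 2
  · obtain ⟨l, hl⟩ := Nat.exists_eq_add_of_le (show k ≤ 2 * a - 4 by omega)
    refine ⟨l, 2 - r, by omega, by omega, ?_⟩
    rw [hl, add_mul]
    omega
  · obtain ⟨l, hl⟩ := Nat.exists_eq_add_of_le (show k + 1 ≤ 2 * a - 4 by omega)
    refine ⟨l, a + 2 - r, by omega, by omega, ?_⟩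
    rw [hl, add_mul, add_mul]
    omega

/-- the semigroups of Theorem 4.10 are pseudo-symmetric. -/
theorem statement_15 (α : ℕ) (hα : 4 ≤ α)
    (S : AddSubmonoid ℕ)
    (hSdef : S = AddSubmonoid.closure
      ({α} ∪ Set.Icc (α * (α - 2) + 3) (α * (α - 1) - 1) ∪ {α * (α - 1) + 1}))
    (γ : ℕ) (hγdef : γ = (2 * α - 4) * α + 2) :
    IsNumericalSemigroup (S : Set ℕ) ∧ IsFrobenius (S : Set ℕ) γ ∧
    2 ∣ γ ∧ γ / 2 = (α - 2) * α + 1 ∧ γ / 2 ∉ S ∧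
    PseudoSymmetric (S : Set ℕ) γ := by
  rw [closure_eq_aperySubmonoid hα] at hSdef
  subst hSdef
  have hdouble : γ = 2 * ((α - 2) * α + 1) := by
    rw [hγdef, show 2 * α - 4 = 2 * (α - 2) by omega]
    ring
  have hdvd : 2 ∣ γ := ⟨_, hdouble⟩
  have hhalf : γ / 2 = (α - 2) * α + 1 := by omega
  have hγ : γ ∉ aperySubmonoid α hα := by
    rw [hγdef, mul_add_mem_aperySubmonoid_iff hα (by omega)]
    unfold AperyCondition
    omega
  have hhalf_notMem : γ / 2 ∉ aperySubmonoid α hα := by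
    rw [hhalf, mul_add_mem_aperySubmonoid_iff hα (by omega)]
    unfold AperyCondition
    omega
  have hle (x : ℕ) (hx : x ∉ aperySubmonoid α hα) : x ≤ γ := by
    by_cases h : x = γ / 2
    · omega
    · rw [hγdef]
      exact (frobenius_sub_mem_aperySubmonoid hα hx (hhalf ▸ h)).1
  refine ⟨⟨zero_mem _, fun _ ha _ hb => add_mem ha hb,
    (Set.finite_Iic γ).subset hle, γ, hγ⟩, ⟨hγ, hle⟩, hdvd, hhalf, hhalf_notMem, hdvd, ?_⟩
  intro x hx hne
  rw [hγdef]
  exact (frobenius_sub_mem_aperySubmonoid hα hx (hhalf ▸ hne)).2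
end

section
/- Let S be a pseudo-symmetric numerical semigroup with Frobenius number γ. Then K = S ∪ {γ/2} ∪ {n ∈ ℕ : n > γ} and ⟨K⟩ = K ∪ {γ}. -/
/-- In a pseudo-symmetric semigroup, half the Frobenius number is a gap. -/
theorem PseudoSymmetric.half_notMem {S : Set ℕ} (hS : IsNumericalSemigroup S) {γ : ℕ}
    (hγ : IsFrobenius S γ) (hps : PseudoSymmetric S γ) : γ / 2 ∉ S := fun h => by
  have h2 := hS.2.1 _ h _ h
  rw [show γ / 2 + γ / 2 = γ by have := hps.1; omega] at h2
  exact hγ.1 h2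

theorem PseudoSymmetric.Kset_eq {S : Set ℕ} (hS : IsNumericalSemigroup S) {γ : ℕ}
    (hγ : IsFrobenius S γ) (hps : PseudoSymmetric S γ) :
    Kset S γ = S ∪ {γ / 2} ∪ {n : ℕ | γ < n} := by
  have hhalf := hps.half_notMem hS hγ
  obtain ⟨h2, hsym⟩ := hps
  ext a
  simp only [Kset, Set.mem_ofPred_eq, Set.mem_union, Set.mem_singleton_iff]
  constructor
  · intro h
    by_contra! hc
    obtain ⟨⟨haS, hah⟩, hle⟩ := hc
    exact h ⟨γ - a, hsym a haS hah, by omega⟩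
  · rintro ((haS | rfl) | hlt) ⟨s, hs, hsum⟩
    · exact hγ.1 (hsum ▸ hS.2.1 s hs a haS)
    · exact hhalf (by rwa [show γ / 2 = s by omega])
    · omega

/-- In a pseudo-symmetric semigroup, translating half the Frobenius number by an element of the
semigroup stays in `K`. -/
theorem PseudoSymmetric.add_half_mem_Kset {S : Set ℕ} (hS : IsNumericalSemigroup S) {γ : ℕ}
    (hγ : IsFrobenius S γ) (hps : PseudoSymmetric S γ) {s : ℕ} (hs : s ∈ S) :
    s + γ / 2 ∈ Kset S γ := by
  rintro ⟨t, ht, hsum⟩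
  have h := hS.2.1 t ht s hs
  rw [show t + s = γ / 2 by have := hps.1; omega] at h
  exact hps.half_notMem hS hγ h

theorem PseudoSymmetric.add_mem_Kset_union {S : Set ℕ} (hS : IsNumericalSemigroup S) {γ : ℕ}
    (hγ : IsFrobenius S γ) (hps : PseudoSymmetric S γ) {a b : ℕ}
    (ha : a ∈ Kset S γ ∪ {γ}) (hb : b ∈ Kset S γ ∪ {γ}) : a + b ∈ Kset S γ ∪ {γ} := by
  have hK := hps.Kset_eq hS hγ
  have hlarge : ∀ n, γ ≤ n → n ∈ Kset S γ ∪ {γ} := fun n hn => by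
    rcases hn.eq_or_lt with rfl | hlt
    · exact Or.inr rfl
    · exact Or.inl (hK ▸ Or.inr hlt)
  have hcases : ∀ n ∈ Kset S γ ∪ {γ}, n ∈ S ∨ n = γ / 2 ∨ γ ≤ n := by
    rw [hK]
    rintro n (((h | h) | h) | h)
    · exact Or.inl h
    · exact Or.inr (Or.inl h)
    · exact Or.inr (Or.inr (le_of_lt h))
    · exact Or.inr (Or.inr (ge_of_eq h))
  rcases hcases a ha with haS | rfl | hle
  · rcases hcases b hb with hbS | rfl | hle
    · exact Or.inl (hK ▸ Or.inl (Or.inl (hS.2.1 a haS b hbS)))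
    · exact Or.inl (hps.add_half_mem_Kset hS hγ haS)
    · exact hlarge _ (by omega)
  · rcases hcases b hb with hbS | rfl | hle
    · rw [add_comm]
      exact Or.inl (hps.add_half_mem_Kset hS hγ hbS)
    · exact hlarge _ (by have := hps.1; omega)
    · exact hlarge _ (by omega)
  · exact hlarge _ (by omega)

/-- for a pseudo-symmetric semigroup,
`K = S ∪ {γ/2} ∪ {n > γ}` and `⟨K⟩ = K ∪ {γ}`. -/
theorem statement_16 (S : Set ℕ) (hS : IsNumericalSemigroup S)
    (γ : ℕ) (hγ : IsFrobenius S γ) (hps : PseudoSymmetric S γ) :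
    Kset S γ = S ∪ {γ / 2} ∪ {n : ℕ | γ < n} ∧
    (AddSubmonoid.closure (Kset S γ) : Set ℕ) = Kset S γ ∪ {γ} := by
  have hK := hps.Kset_eq hS hγ
  refine ⟨hK, Set.Subset.antisymm (fun x hx => ?_) ?_⟩
  · induction hx using AddSubmonoid.closure_induction with
    | mem x hx => exact Or.inl hx
    | zero => exact Or.inl (hK ▸ Or.inl (Or.inl hS.1))
    | add x y _ _ hx hy => exact hps.add_mem_Kset_union hS hγ hx hy
  · refine Set.union_subset AddSubmonoid.subset_closure (Set.singleton_subset_iff.2 ?_)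
    have hhalf : γ / 2 ∈ AddSubmonoid.closure (Kset S γ) :=
      AddSubmonoid.subset_closure (hK ▸ Or.inl (Or.inr rfl))
    have hsum := add_mem hhalf hhalf
    rwa [show γ / 2 + γ / 2 = γ by have := hps.1; omega] at hsum
end
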